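/- arXiv:2404.16338 — 2 statements merged into one kernel-verified Lean document; each statement's English description precedes it below -/
import Mathlib

section
/- Let (Ω, Σ, ν) be a σ-finite measure space, let μ be a σ-finite Borel measure on ℝ, and let a : ℝ × Ω → ℂ be a bounded jointly measurable function. Then the function ω ↦ essSup_{x w.r.t. μ} |a(x, ω)| (the μ-essential supremum of x ↦ |a(x, ω)|) is a measurable function on Ω. -/
open MeasureTheory

/-- Let `(Ω, Σ, ν)` be a σ-finite measure space, `μ` a σ-finite Borel
measure on `ℝ`, and `a : ℝ × Ω → ℂ` a bounded jointly measurable function. Then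
`ω ↦ essSup_{x w.r.t. μ} |a(x, ω)|` is measurable, where the `μ`-essential supremum is the
infimum of all `y ∈ ℝ` such that `μ {x : |a(x,ω)| > y} = 0`. -/
theorem stmt0 {Ω : Type*} [MeasurableSpace Ω] (ν : Measure Ω) [SigmaFinite ν]
    (μ : Measure ℝ) [SigmaFinite μ]
    (a : ℝ × Ω → ℂ) (hmeas : Measurable a) (C : ℝ) (hbdd : ∀ p, ‖a p‖ ≤ C) :
    Measurable (fun ω : Ω => sInf {y : ℝ | μ {x : ℝ | y < ‖a (x, ω)‖} = 0}) := by
  rcases eq_or_ne μ 0 with rfl | hμ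
  · simp
  have hmono : ∀ ω {y z : ℝ}, y ≤ z → μ {x : ℝ | y < ‖a (x, ω)‖} = 0 →
      μ {x : ℝ | z < ‖a (x, ω)‖} = 0 := fun ω y z hyz hy ↦
    measure_mono_null (fun x (hx : z < _) ↦ hyz.trans_lt hx) hy
  have hne : ∀ ω, {y : ℝ | μ {x : ℝ | y < ‖a (x, ω)‖} = 0}.Nonempty := fun ω ↦
    ⟨C, by simp [(hbdd _).not_gt]⟩
  have hbelow : ∀ ω, BddBelow {y : ℝ | μ {x : ℝ | y < ‖a (x, ω)‖} = 0} := fun ω ↦ by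
    refine ⟨0, fun y hy ↦ le_of_not_gt fun hy0 ↦ hμ ?_⟩
    rw [← Measure.measure_univ_eq_zero]
    exact measure_mono_null (fun x _ ↦ hy0.trans_le (norm_nonneg _)) hy
  have hnull : ∀ y : ℝ, MeasurableSet {ω | μ {x : ℝ | y < ‖a (x, ω)‖} = 0} := fun y ↦
    measurable_measure_prodMk_right (measurableSet_lt measurable_const hmeas.norm)
      (measurableSet_singleton 0)
  refine measurable_of_Iio fun c ↦ ?_
  have hIio : (fun ω ↦ sInf {y : ℝ | μ {x : ℝ | y < ‖a (x, ω)‖} = 0}) ⁻¹' Set.Iio c =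
      ⋃ (q : ℚ) (_ : (q : ℝ) < c), {ω | μ {x : ℝ | (q : ℝ) < ‖a (x, ω)‖} = 0} := by
    ext ω
    simp only [Set.mem_preimage, Set.mem_Iio, Set.mem_iUnion, Set.mem_ofPred_eq, exists_prop,
      csInf_lt_iff (hbelow ω) (hne ω)]
    constructor
    · rintro ⟨y, hy, hyc⟩
      obtain ⟨q, hyq, hqc⟩ := exists_rat_btwn hyc
      exact ⟨q, hqc, hmono ω hyq.le hy⟩
    · rintro ⟨q, hqc, hq⟩
      exact ⟨q, hq, hqc⟩
  rw [hIio]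
  exact .iUnion fun q ↦ .iUnion fun _ ↦ hnull q
end

section
/- Let n ≥ 0 and α_0, …, α_n, β_0, …, β_n ∈ ℝ. If φ ∈ S^{α_0}(ℝ) ⊠_i ⋯ ⊠_i S^{α_n}(ℝ) and ψ ∈ S^{β_0}(ℝ) ⊠_i ⋯ ⊠_i S^{β_n}(ℝ), then the pointwise product Φ(λ_0, …, λ_n) := φ(λ_0, …, λ_n) ψ(λ_0, …, λ_n) belongs to S^{α_0+β_0}(ℝ) ⊠_i ⋯ ⊠_i S^{α_n+β_n}(ℝ). -/
open MeasureTheory Filter Topology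
open scoped ENNReal NNReal

noncomputable section

/-- The Japanese bracket `⟨x⟩ = (1 + x²)^(1/2)`. -/
def jb (x : ℝ) : ℝ := Real.sqrt (1 + x ^ 2)

/-- The weight `‖f⁽ᵏ⁾(x)‖ ⟨x⟩^(k−β)` defining the `S^β` seminorms. -/
def sWeight (β : ℝ) (k : ℕ) (f : ℝ → ℂ) (x : ℝ) : ℝ :=
  ‖iteratedDeriv k f x‖ * jb x ^ ((k : ℝ) - β)

/-- The `S^β` seminorm `‖f‖_{S^β,k} = sup_x ‖f⁽ᵏ⁾(x)‖ ⟨x⟩^(k−β)`. -/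
def SNorm (β : ℝ) (k : ℕ) (f : ℝ → ℂ) : ℝ := ⨆ x : ℝ, sWeight β k f x

/-- Membership in `S^β(ℝ)`: smooth with all the seminorms finite. -/
def MemS (β : ℝ) (f : ℝ → ℂ) : Prop :=
  ContDiff ℝ (⊤ : ℕ∞) f ∧ ∀ k : ℕ, BddAbove (Set.range (sWeight β k f))

/-- The weight `‖f⁽ᵏ⁾(x)‖ ⟨x⟩^(k−β−1)` defining the `T^β` seminorms. -/
def tWeight (β : ℝ) (k : ℕ) (f : ℝ → ℂ) (x : ℝ) : ℝ :=
  ‖iteratedDeriv k f x‖ * jb x ^ ((k : ℝ) - β - 1)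

/-- The `T^β` seminorm `‖f‖_{T^β,k} = ∫ ‖f⁽ᵏ⁾(x)‖ ⟨x⟩^(k−β−1) dx`. -/
def TNorm (β : ℝ) (k : ℕ) (f : ℝ → ℂ) : ℝ := ∫ x : ℝ, tWeight β k f x

/-- Membership in `T^β(ℝ)`: smooth with all the seminorms finite. -/
def MemT (β : ℝ) (f : ℝ → ℂ) : Prop :=
  ContDiff ℝ (⊤ : ℕ∞) f ∧ ∀ k : ℕ, Integrable (tWeight β k f)

/-- `F` is the sequence of divided differences of `f`: `F 0 = f`, each `F m` is
continuous, and the divided-difference recursion holds off the diagonal. -/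
def IsDivDiff (f : ℝ → ℂ) (F : (m : ℕ) → (Fin (m + 1) → ℝ) → ℂ) : Prop :=
  (∀ x : Fin 1 → ℝ, F 0 x = f (x 0)) ∧
  (∀ m, Continuous (F m)) ∧
  (∀ m, ∀ x : Fin (m + 2) → ℝ, x 0 ≠ x (Fin.last (m + 1)) →
    F (m + 1) x = (F m (fun i => x i.succ) - F m (fun i => x i.castSucc)) /
      ((x 0 - x (Fin.last (m + 1)) : ℝ) : ℂ))

end
noncomputable section

open MeasureTheory
open scoped ENNReal

/-- `(Ω, mΩ, ν, a)` is an admissible integral representation of the symbol `φ`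
witnessing membership in `S^{β 0}(ℝ) ⊠ᵢ ⋯ ⊠ᵢ S^{β n}(ℝ)`. -/
def IsBoxRep {n : ℕ} (β : Fin (n + 1) → ℝ) (φ : (Fin (n + 1) → ℝ) → ℂ)
    (Ω : Type) (mΩ : MeasurableSpace Ω) (ν : @Measure Ω mΩ)
    (a : Fin (n + 1) → ℝ → Ω → ℂ) : Prop :=
  SigmaFinite ν ∧
  (∀ j, Measurable (Function.uncurry (a j))) ∧
  (∀ j ω, MemS (β j) (fun x => a j x ω)) ∧
  (∀ j k, Measurable fun ω => SNorm (β j) k (fun x => a j x ω)) ∧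
  (∀ lam : Fin (n + 1) → ℝ, φ lam = ∫ ω, ∏ j, a j (lam j) ω ∂ν) ∧
  (∀ k : Fin (n + 1) → ℕ,
    Integrable (fun ω => ∏ j, SNorm (β j) (k j) (fun x => a j x ω)) ν)

/-- Membership of `φ` in `S^{β 0}(ℝ) ⊠ᵢ ⋯ ⊠ᵢ S^{β n}(ℝ)`. -/
def MemBox {n : ℕ} (β : Fin (n + 1) → ℝ) (φ : (Fin (n + 1) → ℝ) → ℂ) : Prop :=
  ∃ (Ω : Type) (mΩ : MeasurableSpace Ω) (ν : @Measure Ω mΩ)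
    (a : Fin (n + 1) → ℝ → Ω → ℂ), IsBoxRep β φ Ω mΩ ν a

/-- The seminorm `‖φ‖_{k_0,…,k_n}` of `S^{β 0}(ℝ) ⊠ᵢ ⋯ ⊠ᵢ S^{β n}(ℝ)`: the infimum,
over all admissible representations, of `∫ ∏_j ‖a_j(·,ω)‖_{S^{β_j},k_j} dν(ω)`. -/
def boxNorm {n : ℕ} (β : Fin (n + 1) → ℝ) (k : Fin (n + 1) → ℕ)
    (φ : (Fin (n + 1) → ℝ) → ℂ) : ℝ≥0∞ :=
  sInf { M : ℝ≥0∞ | ∃ (Ω : Type) (mΩ : MeasurableSpace Ω) (ν : @Measure Ω mΩ)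
    (a : Fin (n + 1) → ℝ → Ω → ℂ), IsBoxRep β φ Ω mΩ ν a ∧
    M = ∫⁻ ω, ∏ j, ENNReal.ofReal (SNorm (β j) (k j) (fun x => a j x ω)) ∂ν }

end

theorem jb_pos (x : ℝ) : 0 < jb x := Real.sqrt_pos.2 (by positivity)

theorem continuous_jb : Continuous jb := by
  unfold jb
  fun_prop

theorem sWeight_nonneg (β : ℝ) (k : ℕ) (f : ℝ → ℂ) (x : ℝ) : 0 ≤ sWeight β k f x :=
  mul_nonneg (norm_nonneg _) (Real.rpow_nonneg (jb_pos x).le _)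

theorem SNorm_nonneg (β : ℝ) (k : ℕ) (f : ℝ → ℂ) : 0 ≤ SNorm β k f :=
  Real.iSup_nonneg (sWeight_nonneg β k f)

theorem MemS.sWeight_le_SNorm {β : ℝ} {f : ℝ → ℂ} (hf : MemS β f) (k : ℕ) (x : ℝ) :
    sWeight β k f x ≤ SNorm β k f :=
  le_ciSup (hf.2 k) x

theorem MemS.continuous_sWeight {β : ℝ} {f : ℝ → ℂ} (hf : MemS β f) (k : ℕ) :
    Continuous (sWeight β k f) :=
  (hf.1.continuous_iteratedDeriv k (by exact_mod_cast le_top)).norm.mul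
    (continuous_jb.rpow_const fun x => Or.inl (jb_pos x).ne')

theorem sWeight_mul_le {α β : ℝ} {f g : ℝ → ℂ} (hf : MemS α f) (hg : MemS β g) (k : ℕ) (x : ℝ) :
    sWeight (α + β) k (fun y => f y * g y) x ≤
      ∑ i ∈ Finset.range (k + 1), (k.choose i : ℝ) * (SNorm α i f * SNorm β (k - i) g) := by
  have hleib : iteratedDeriv k (fun y => f y * g y) x = ∑ i ∈ Finset.range (k + 1),
      (k.choose i : ℂ) * iteratedDeriv i f x * iteratedDeriv (k - i) g x :=
    iteratedDeriv_mul (hf.1.of_le (by exact_mod_cast le_top)).contDiffAt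
      (hg.1.of_le (by exact_mod_cast le_top)).contDiffAt
  unfold sWeight
  rw [hleib]
  refine (mul_le_mul_of_nonneg_right (norm_sum_le _ _)
    (Real.rpow_nonneg (jb_pos x).le _)).trans ?_
  rw [Finset.sum_mul]
  refine Finset.sum_le_sum fun i hi => ?_
  have hik : i ≤ k := Nat.lt_succ_iff.1 (Finset.mem_range.1 hi)
  have hexp : jb x ^ ((k : ℝ) - (α + β)) =
      jb x ^ ((i : ℝ) - α) * jb x ^ (((k - i : ℕ) : ℝ) - β) := by
    rw [← Real.rpow_add (jb_pos x), Nat.cast_sub hik]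
    congr 1
    ring
  calc ‖(k.choose i : ℂ) * iteratedDeriv i f x * iteratedDeriv (k - i) g x‖ *
        jb x ^ ((k : ℝ) - (α + β))
      = (k.choose i : ℝ) * (sWeight α i f x * sWeight β (k - i) g x) := by
        rw [hexp, norm_mul, norm_mul, Complex.norm_natCast]
        unfold sWeight
        ring
    _ ≤ _ := mul_le_mul_of_nonneg_left
        (mul_le_mul (hf.sWeight_le_SNorm i x) (hg.sWeight_le_SNorm (k - i) x)
          (sWeight_nonneg _ _ _ _) (SNorm_nonneg _ _ _)) (Nat.cast_nonneg _)

theorem MemS.mul {α β : ℝ} {f g : ℝ → ℂ} (hf : MemS α f) (hg : MemS β g) :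
    MemS (α + β) (fun x => f x * g x) :=
  ⟨hf.1.mul hg.1, fun k => ⟨_, Set.forall_mem_range.2 (sWeight_mul_le hf hg k)⟩⟩

theorem SNorm_mul_le {α β : ℝ} {f g : ℝ → ℂ} (hf : MemS α f) (hg : MemS β g) (k : ℕ) :
    SNorm (α + β) k (fun y => f y * g y) ≤
      ∑ i ∈ Finset.range (k + 1), (k.choose i : ℝ) * (SNorm α i f * SNorm β (k - i) g) :=
  ciSup_le (sWeight_mul_le hf hg k)

theorem measurable_deriv_of_differentiable {Ω : Type*} [MeasurableSpace Ω] {c : ℝ → Ω → ℂ}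
    (hc : ∀ x, Measurable (c x)) (hd : ∀ ω, Differentiable ℝ fun x => c x ω) (x : ℝ) :
    Measurable fun ω => deriv (fun y => c y ω) x := by
  have hu : Tendsto (fun m : ℕ => 1 / ((m : ℝ) + 1)) atTop (𝓝[>] 0) :=
    tendsto_nhdsWithin_iff.2 ⟨tendsto_one_div_add_atTop_nhds_zero_nat,
      Eventually.of_forall fun m => by
        have : (0 : ℝ) < 1 / ((m : ℝ) + 1) := by positivity
        exact this⟩
  refine measurable_of_tendsto_metrizable
    (f := fun (m : ℕ) ω => (1 / ((m : ℝ) + 1))⁻¹ • (c (x + 1 / ((m : ℝ) + 1)) ω - c x ω))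
    (fun m => Measurable.fun_const_smul ((hc _).sub (hc x)) _) ?_
  exact tendsto_pi_nhds.2 fun ω => (hd ω x).hasDerivAt.tendsto_slope_zero_right.comp hu

theorem measurable_iteratedDeriv_of_contDiff {Ω : Type*} [MeasurableSpace Ω] {c : ℝ → Ω → ℂ}
    (hc : ∀ x, Measurable (c x)) (hd : ∀ ω, ContDiff ℝ (⊤ : ℕ∞) fun x => c x ω) (k : ℕ) (x : ℝ) :
    Measurable fun ω => iteratedDeriv k (fun y => c y ω) x := by
  induction k generalizing x with
  | zero => simpa using hc x
  | succ k ih =>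
    simp only [iteratedDeriv_succ]
    exact measurable_deriv_of_differentiable (c := fun y ω => iteratedDeriv k (fun z => c z ω) y)
      ih (fun ω => (hd ω).differentiable_iteratedDeriv k (by exact_mod_cast ENat.natCast_lt_top k)) x

theorem measurable_SNorm {Ω : Type*} [MeasurableSpace Ω] {β : ℝ} {c : ℝ → Ω → ℂ}
    (hc : ∀ x, Measurable (c x)) (hS : ∀ ω, MemS β fun x => c x ω) (k : ℕ) :
    Measurable fun ω => SNorm β k fun x => c x ω := by
  obtain ⟨s, hs, hsd⟩ := TopologicalSpace.exists_countable_dense ℝ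
  have := hs.to_subtype
  have heq : (fun ω => SNorm β k fun x => c x ω) =
      fun ω => ⨆ x : s, sWeight β k (fun y => c y ω) x :=
    funext fun ω => (hsd.ciSup' ((hS ω).continuous_sWeight k)).symm
  rw [heq]
  exact Measurable.iSup fun x =>
    (measurable_iteratedDeriv_of_contDiff hc (fun ω => (hS ω).1) k x).norm.mul_const _

theorem integrable_prod_SNorm_mul {ι Ω Ω' : Type*} [Fintype ι] [MeasurableSpace Ω]
    [MeasurableSpace Ω'] {μ : Measure Ω} {ν : Measure Ω'} [SFinite μ] [SFinite ν] {α β : ι → ℝ}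
    {a : ι → ℝ → Ω → ℂ} {b : ι → ℝ → Ω' → ℂ}
    (ha : ∀ j ω, MemS (α j) fun x => a j x ω) (hb : ∀ j ω, MemS (β j) fun x => b j x ω)
    (hai : ∀ k : ι → ℕ, Integrable (fun ω => ∏ j, SNorm (α j) (k j) fun x => a j x ω) μ)
    (hbi : ∀ k : ι → ℕ, Integrable (fun ω => ∏ j, SNorm (β j) (k j) fun x => b j x ω) ν)
    (hm : ∀ j k, Measurable fun p : Ω × Ω' =>
      SNorm (α j + β j) k fun x => a j x p.1 * b j x p.2) (k : ι → ℕ) :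
    Integrable (fun p : Ω × Ω' =>
      ∏ j, SNorm (α j + β j) (k j) fun x => a j x p.1 * b j x p.2) (μ.prod ν) := by
  classical
  have hdom : Integrable (fun p : Ω × Ω' =>
      ∑ i ∈ Fintype.piFinset fun j => Finset.range (k j + 1),
        (∏ j, ((k j).choose (i j) : ℝ)) *
          ((∏ j, SNorm (α j) (i j) fun x => a j x p.1) *
            ∏ j, SNorm (β j) (k j - i j) fun x => b j x p.2)) (μ.prod ν) :=
    integrable_finsetSum _ fun i _ =>
      ((hai i).mul_prod (hbi fun j => k j - i j)).const_mul _
  refine hdom.mono' (Finset.measurable_fun_prod _ fun j _ => hm j (k j)).aestronglyMeasurable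
    (Eventually.of_forall fun p => ?_)
  rw [Real.norm_of_nonneg (Finset.prod_nonneg fun j _ => SNorm_nonneg _ _ _)]
  refine (Finset.prod_le_prod (fun j _ => SNorm_nonneg _ _ _)
    fun j _ => SNorm_mul_le (ha j p.1) (hb j p.2) (k j)).trans_eq ?_
  simp only [Finset.prod_univ_sum, Finset.prod_mul_distrib]

/-- If `φ ∈ S^{α_0}(ℝ) ⊠ᵢ ⋯ ⊠ᵢ S^{α_n}(ℝ)` and
`ψ ∈ S^{β_0}(ℝ) ⊠ᵢ ⋯ ⊠ᵢ S^{β_n}(ℝ)`, then the pointwise product `φ · ψ` belongs to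
`S^{α_0+β_0}(ℝ) ⊠ᵢ ⋯ ⊠ᵢ S^{α_n+β_n}(ℝ)`. -/
theorem stmt3 {n : ℕ} (α β : Fin (n + 1) → ℝ)
    (φ ψ : (Fin (n + 1) → ℝ) → ℂ)
    (hφ : MemBox α φ) (hψ : MemBox β ψ) :
    MemBox (fun j => α j + β j) (fun lam => φ lam * ψ lam) := by
  obtain ⟨Ω, mΩ, μ, a, hμ, ham, haS, -, hφa, hai⟩ := hφ
  obtain ⟨Ω', mΩ', ν, b, hν, hbm, hbS, -, hψb, hbi⟩ := hψ
  have hcm : ∀ j, Measurable (Function.uncurry fun (x : ℝ) (p : Ω × Ω') =>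
      a j x p.1 * b j x p.2) := fun j =>
    ((ham j).comp (measurable_fst.prodMk (measurable_fst.comp measurable_snd))).mul
      ((hbm j).comp (measurable_fst.prodMk (measurable_snd.comp measurable_snd)))
  have hcS : ∀ j (p : Ω × Ω'), MemS (α j + β j) fun x => a j x p.1 * b j x p.2 :=
    fun j p => (haS j p.1).mul (hbS j p.2)
  have hcN : ∀ j k, Measurable fun p : Ω × Ω' =>
      SNorm (α j + β j) k fun x => a j x p.1 * b j x p.2 := fun j k =>
    measurable_SNorm (c := fun x (p : Ω × Ω') => a j x p.1 * b j x p.2)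
      (fun x => (hcm j).comp measurable_prodMk_left) (hcS j) k
  refine ⟨Ω × Ω', inferInstance, μ.prod ν, fun j x p => a j x p.1 * b j x p.2,
    inferInstance, hcm, hcS, hcN, fun lam => ?_,
    integrable_prod_SNorm_mul haS hbS hai hbi hcN⟩
  simp only [Finset.prod_mul_distrib, hφa, hψb]
  exact (integral_prod_mul (fun ω => ∏ j, a j (lam j) ω) fun ω => ∏ j, b j (lam j) ω).symm
end
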